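/- arXiv:2103.03507 — 3 statements merged into one kernel-verified Lean document; each statement's English description precedes it below -/
import Mathlib

section
/- (Proposition 1) Let the digraph be strongly connected and weight-balanced, and suppose A x = b has at least one solution. Then for all α, β > 0, every trajectory x : [0,∞) → ℝ^{mn} of the centralized dynamics ẋ = −α𝐋x − β𝒜ᵀ𝟙_m𝟙_mᵀ(𝒜x − 𝐛) converges exponentially to a point x* = 𝟙_n ⊗ x̂, where x̂ ∈ ℝ^m solves A x̂ = b; that is, there exist C, κ > 0 such that ‖x(t) − x*‖ ≤ C e^{−κt} for all t ≥ 0. -/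
open Matrix

noncomputable section

/-- Laplacian `L = D^in − Adj`, where `D^in` is the diagonal matrix of weighted
in-degrees (column sums of `Adj`). -/
def lap {n : ℕ} (Adj : Matrix (Fin n) (Fin n) ℝ) : Matrix (Fin n) (Fin n) ℝ :=
  Matrix.diagonal (fun i => ∑ j, Adj j i) - Adj

/-- Strong connectivity: there is a directed path between any two distinct
vertices, where there is an edge from `i` to `j` iff `Adj i j > 0`. -/
def StronglyConnected {n : ℕ} (Adj : Matrix (Fin n) (Fin n) ℝ) : Prop :=
  ∀ i j : Fin n, i ≠ j → Relation.TransGen (fun a b => 0 < Adj a b) i j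

/-- Weight-balanced: `L 𝟙 = 0`. -/
def WeightBalanced {n : ℕ} (Adj : Matrix (Fin n) (Fin n) ℝ) : Prop :=
  (lap Adj).mulVec (fun _ => (1 : ℝ)) = 0

/-- `𝐋 = L ⊗ I_m`. -/
def bigL (m : ℕ) {n : ℕ} (Adj : Matrix (Fin n) (Fin n) ℝ) :
    Matrix (Fin n × Fin m) (Fin n × Fin m) ℝ :=
  Matrix.kroneckerMap (· * ·) (lap Adj) (1 : Matrix (Fin m) (Fin m) ℝ)

/-- `𝒜 = blockdiag(A_1, …, A_n)`. -/
def blkDiag {n m : ℕ} (A : Fin n → Matrix (Fin m) (Fin m) ℝ) :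
    Matrix (Fin n × Fin m) (Fin n × Fin m) ℝ :=
  fun p q => if p.1 = q.1 then A p.1 p.2 q.2 else 0

/-- `𝟙_m = 𝟙_n ⊗ I_m`. -/
def onesM (n m : ℕ) : Matrix (Fin n × Fin m) (Fin m) ℝ :=
  fun p j => if p.2 = j then 1 else 0

/-- The stacked vector `𝐛 = (b_1; …; b_n)`. -/
def stackVec {n m : ℕ} (b : Fin n → Fin m → ℝ) : Fin n × Fin m → ℝ := fun p => b p.1 p.2

/-- The consensus vector `𝟙_n ⊗ x`. -/
def consensus (n : ℕ) {m : ℕ} (x : Fin m → ℝ) : Fin n × Fin m → ℝ := fun p => x p.2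

/-- Right-hand side of the centralized dynamics
`ẋ = −α𝐋x − β𝒜ᵀ𝟙_m𝟙_mᵀ(𝒜x − 𝐛)`. -/
def rhsCentral {n m : ℕ} (Adj : Matrix (Fin n) (Fin n) ℝ)
    (A : Fin n → Matrix (Fin m) (Fin m) ℝ) (b : Fin n → Fin m → ℝ) (α β : ℝ)
    (x : Fin n × Fin m → ℝ) : Fin n × Fin m → ℝ :=
  -(α • (bigL m Adj).mulVec x)
    - β • ((blkDiag A)ᵀ * onesM n m * (onesM n m)ᵀ).mulVec
        ((blkDiag A).mulVec x - stackVec b)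

open scoped InnerProductSpace

section Dissipative

variable {E : Type*} [NormedAddCommGroup E] [InnerProductSpace ℝ E]

/-- If the quadratic form of `T` is nonnegative, the range of `T` is orthogonal to its kernel. -/
lemma inner_apply_eq_zero_of_apply_eq_zero (T : E →L[ℝ] E) (hT : ∀ z, 0 ≤ ⟪T z, z⟫_ℝ)
    {z : E} (hz : T z = 0) (y : E) : ⟪T y, z⟫_ℝ = 0 := by
  have key : ∀ s : ℝ, 0 ≤ ⟪T y, y⟫_ℝ + s * ⟪T y, z⟫_ℝ := fun s => by
    simpa [map_add, map_smul, hz, inner_add_right, inner_smul_right] using hT (y + s • z)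
  by_contra h
  have h1 := key (-(⟪T y, y⟫_ℝ + 1) / ⟪T y, z⟫_ℝ)
  rw [div_mul_cancel₀ _ h] at h1
  linarith

/-- A quadratic form that is nonnegative and vanishes only on the kernel of `T` is coercive on
the orthogonal complement of the kernel. -/
lemma exists_coercive_on_ker_orthogonal [FiniteDimensional ℝ E] (T : E →L[ℝ] E)
    (hT : ∀ z, 0 ≤ ⟪T z, z⟫_ℝ) (hker : ∀ z, ⟪T z, z⟫_ℝ = 0 → T z = 0) :
    ∃ κ : ℝ, 0 < κ ∧ ∀ w : E, (∀ k, T k = 0 → ⟪w, k⟫_ℝ = 0) → κ * ‖w‖ ^ 2 ≤ ⟪T w, w⟫_ℝ := by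
  let S : Set E := Metric.sphere 0 1 ∩ {w | ∀ k, T k = 0 → ⟪w, k⟫_ℝ = 0}
  have hclosed : IsClosed {w : E | ∀ k, T k = 0 → ⟪w, k⟫_ℝ = 0} := by
    simp only [Set.ofPred_forall]
    exact isClosed_iInter fun k => isClosed_iInter fun _ =>
      isClosed_eq (by fun_prop) continuous_const
  have hS : IsCompact S := (isCompact_sphere 0 1).inter_right hclosed
  have hunit : ∀ w : E, (∀ k, T k = 0 → ⟪w, k⟫_ℝ = 0) → w ≠ 0 → ‖w‖⁻¹ • w ∈ S := by
    refine fun w hw hw0 => ⟨?_, fun k hk => ?_⟩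
    · simp [norm_smul, norm_ne_zero_iff.2 hw0]
    · simp [inner_smul_left, hw k hk]
  rcases S.eq_empty_or_nonempty with hempty | hne
  · refine ⟨1, one_pos, fun w hw => ?_⟩
    by_cases hw0 : w = 0
    · simp [hw0]
    · exact absurd (hunit w hw hw0) (by simp [hempty])
  · obtain ⟨u, hu, hmin⟩ := hS.exists_isMinOn hne
      (f := fun w => ⟪T w, w⟫_ℝ) (by fun_prop)
    refine ⟨⟪T u, u⟫_ℝ, lt_of_le_of_ne (hT u) fun h => ?_, fun w hw => ?_⟩
    · have h0 : ⟪u, u⟫_ℝ = 0 := hu.2 u (hker u h.symm)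
      have h1 : ‖u‖ = 1 := by simpa using hu.1
      rw [inner_self_eq_zero] at h0
      simp [h0] at h1
    · by_cases hw0 : w = 0
      · simp [hw0]
      · have h := hmin (hunit w hw hw0)
        have hpos : 0 < ‖w‖ := norm_pos_iff.2 hw0
        simp only [Set.mem_ofPred_eq, map_smul, inner_smul_left, inner_smul_right,
          RCLike.conj_to_real] at h
        calc ⟪T u, u⟫_ℝ * ‖w‖ ^ 2
            ≤ (‖w‖⁻¹ * (‖w‖⁻¹ * ⟪T w, w⟫_ℝ)) * ‖w‖ ^ 2 := by gcongr
          _ = ⟪T w, w⟫_ℝ := by field_simp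

/-- Scalar decay: `g' ≤ -c g` on `[0, ∞)` gives `g t ≤ g 0 * exp (-c t)`. -/
lemma le_mul_exp_of_hasDerivAt_le {g g' : ℝ → ℝ} {c : ℝ}
    (hg : ∀ t, 0 ≤ t → HasDerivAt g (g' t) t) (hle : ∀ t, 0 ≤ t → g' t ≤ -c * g t)
    {t : ℝ} (ht : 0 ≤ t) : g t ≤ g 0 * Real.exp (-c * t) := by
  have hd : ∀ s, 0 ≤ s → HasDerivAt (fun s => g s * Real.exp (c * s))
      (g' s * Real.exp (c * s) + g s * (Real.exp (c * s) * c)) s := fun s hs =>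
    (hg s hs).mul (((hasDerivAt_id s).const_mul c).exp.congr_deriv (by simp))
  have hanti : AntitoneOn (fun s => g s * Real.exp (c * s)) (Set.Ici 0) := by
    refine antitoneOn_of_deriv_nonpos (convex_Ici 0)
      (fun s hs => (hd s hs).continuousAt.continuousWithinAt)
      (fun s hs => (hd s (interior_subset hs)).differentiableAt.differentiableWithinAt)
      fun s hs => ?_
    rw [(hd s (interior_subset hs)).deriv]
    have h := hle s (interior_subset hs)
    nlinarith [Real.exp_pos (c * s)]
  have h := hanti Set.self_mem_Ici ht ht
  simp only [mul_zero, Real.exp_zero, mul_one] at h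
  calc g t = g t * Real.exp (c * t) * Real.exp (-c * t) := by
        rw [mul_assoc, ← Real.exp_add]; simp
    _ ≤ g 0 * Real.exp (-c * t) := by gcongr

/-- Trajectories of `ż = -T z` converge exponentially to a point of the kernel of `T` when the
quadratic form of `T` is nonnegative and vanishes only on that kernel. -/
theorem exists_exponential_limit_of_dissipative [FiniteDimensional ℝ E] (T : E →L[ℝ] E)
    (hT : ∀ z, 0 ≤ ⟪T z, z⟫_ℝ) (hker : ∀ z, ⟪T z, z⟫_ℝ = 0 → T z = 0)
    {z : ℝ → E} (hz : ∀ t, 0 ≤ t → HasDerivAt z (-T (z t)) t) :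
    ∃ p : E, T p = 0 ∧ ∃ C κ : ℝ, 0 < C ∧ 0 < κ ∧
      ∀ t, 0 ≤ t → ‖z t - p‖ ≤ C * Real.exp (-κ * t) := by
  obtain ⟨κ, hκ, hcoer⟩ := exists_coercive_on_ker_orthogonal T hT hker
  let K : Submodule ℝ E := LinearMap.ker (T : E →ₗ[ℝ] E)
  let p : E := K.starProjection (z 0)
  have hp : T p = 0 := K.starProjection_apply_mem (z 0)
  have hd : ∀ t, 0 ≤ t → HasDerivAt (fun s => z s - p) (-T (z t - p)) t := fun t ht => by
    simpa [hp] using (hz t ht).sub_const p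
  have horth : ∀ t, 0 ≤ t → ∀ k, T k = 0 → ⟪z t - p, k⟫_ℝ = 0 := fun t ht k hk => by
    have hdk : ∀ s, 0 ≤ s → HasDerivAt (fun s => ⟪z s - p, k⟫_ℝ) 0 s := fun s hs => by
      have h := (hd s hs).inner ℝ (hasDerivAt_const s k)
      rwa [inner_zero_right, zero_add, inner_neg_left,
        inner_apply_eq_zero_of_apply_eq_zero T hT hk, neg_zero] at h
    have hconst := constant_of_has_deriv_right_zero
      (fun s hs => (hdk s hs.1).continuousAt.continuousWithinAt)
      (fun s hs => (hdk s hs.1).hasDerivWithinAt) t (Set.right_mem_Icc.2 ht)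
    rw [hconst]
    exact K.starProjection_inner_eq_zero (z 0) k hk
  refine ⟨p, hp, ‖z 0 - p‖ + 1, κ, by positivity, hκ, fun t ht => ?_⟩
  have hsq : ‖z t - p‖ ^ 2 ≤ ‖z 0 - p‖ ^ 2 * Real.exp (-(2 * κ) * t) := by
    refine le_mul_exp_of_hasDerivAt_le (g := fun s => ‖z s - p‖ ^ 2)
      (fun s hs => (hd s hs).norm_sq) (fun s hs => ?_) ht
    have h := hcoer _ (horth s hs)
    rw [real_inner_comm] at h
    simp only [inner_neg_right]
    linarith
  have hexp : Real.exp (-(2 * κ) * t) = Real.exp (-κ * t) ^ 2 := by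
    rw [← Real.exp_nat_mul]; ring_nf
  rw [hexp, ← mul_pow] at hsq
  have h := (pow_le_pow_iff_left₀ (norm_nonneg _) (by positivity) two_ne_zero).1 hsq
  nlinarith [Real.exp_pos (-κ * t)]

end Dissipative

section Network

variable {n m : ℕ}

lemma WeightBalanced.sum_row_eq_sum_col {Adj : Matrix (Fin n) (Fin n) ℝ}
    (hWB : WeightBalanced Adj) (i : Fin n) : ∑ j, Adj i j = ∑ j, Adj j i := by
  have h := congrFun hWB i
  simp only [lap, sub_mulVec, Pi.sub_apply, mulVec_diagonal, Pi.zero_apply] at h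
  simp only [mulVec, dotProduct, mul_one] at h
  linarith

/-- The Laplacian quadratic form of a weight-balanced digraph. -/
lemma WeightBalanced.dotProduct_lap_mulVec {Adj : Matrix (Fin n) (Fin n) ℝ}
    (hWB : WeightBalanced Adj) (u : Fin n → ℝ) :
    (lap Adj *ᵥ u) ⬝ᵥ u = (∑ i, ∑ j, Adj i j * (u i - u j) ^ 2) / 2 := by
  have h1 : (lap Adj *ᵥ u) ⬝ᵥ u
      = ∑ i, (∑ j, Adj j i) * u i ^ 2 - ∑ i, ∑ j, Adj i j * u i * u j := by
    rw [lap, sub_mulVec, sub_dotProduct]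
    congr 1
    · simp only [dotProduct, mulVec_diagonal]
      exact Finset.sum_congr rfl fun i _ => by ring
    · simp only [dotProduct, mulVec, Finset.sum_mul]
      exact Finset.sum_congr rfl fun i _ => Finset.sum_congr rfl fun j _ => by ring
  have h2 : ∑ i, ∑ j, Adj i j * (u i - u j) ^ 2
      = ∑ i, (∑ j, Adj i j) * u i ^ 2 + ∑ i, ∑ j, Adj i j * u j ^ 2
        - 2 * ∑ i, ∑ j, Adj i j * u i * u j := by
    simp only [Finset.sum_mul, Finset.mul_sum, ← Finset.sum_add_distrib,
      ← Finset.sum_sub_distrib]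
    exact Finset.sum_congr rfl fun i _ => Finset.sum_congr rfl fun j _ => by ring
  have h3 : ∑ i, ∑ j, Adj i j * u j ^ 2 = ∑ i, (∑ j, Adj j i) * u i ^ 2 := by
    rw [Finset.sum_comm]
    simp only [Finset.sum_mul]
  simp only [hWB.sum_row_eq_sum_col] at h2
  rw [h1, h2, h3]
  ring

lemma StronglyConnected.eq_of_edges {Adj : Matrix (Fin n) (Fin n) ℝ}
    (hSC : StronglyConnected Adj) {u : Fin n → ℝ} (hu : ∀ i j, 0 < Adj i j → u i = u j)
    (i j : Fin n) : u i = u j := by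
  by_cases hij : i = j
  · rw [hij]
  · have hpath := hSC i j hij
    clear hij
    induction hpath with
    | single h => exact hu _ _ h
    | tail _ h ih => exact ih.trans (hu _ _ h)

lemma bigL_mulVec_apply (Adj : Matrix (Fin n) (Fin n) ℝ) (z : Fin n × Fin m → ℝ)
    (i : Fin n) (k : Fin m) : (bigL m Adj *ᵥ z) (i, k) = (lap Adj *ᵥ fun j => z (j, k)) i := by
  simp [bigL, mulVec, dotProduct, Fintype.sum_prod_type, one_apply]

lemma bigL_mulVec_dotProduct (Adj : Matrix (Fin n) (Fin n) ℝ) (z : Fin n × Fin m → ℝ) :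
    (bigL m Adj *ᵥ z) ⬝ᵥ z
      = ∑ k, (lap Adj *ᵥ fun j => z (j, k)) ⬝ᵥ fun j => z (j, k) := by
  simp only [dotProduct, Fintype.sum_prod_type, bigL_mulVec_apply]
  exact Finset.sum_comm

lemma WeightBalanced.bigL_mulVec_consensus {Adj : Matrix (Fin n) (Fin n) ℝ}
    (hWB : WeightBalanced Adj) (v : Fin m → ℝ) : bigL m Adj *ᵥ consensus n v = 0 := by
  ext ⟨i, k⟩
  have h : (fun j : Fin n => consensus n v (j, k)) = v k • fun _ => (1 : ℝ) := by
    ext j; simp [consensus]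
  rw [bigL_mulVec_apply, h, mulVec_smul, show lap Adj *ᵥ (fun _ => (1 : ℝ)) = 0 from hWB]
  simp

lemma WeightBalanced.bigL_mulVec_dotProduct_nonneg {Adj : Matrix (Fin n) (Fin n) ℝ}
    (hWB : WeightBalanced Adj) (hAdj : ∀ i j, 0 ≤ Adj i j) (z : Fin n × Fin m → ℝ) :
    0 ≤ (bigL m Adj *ᵥ z) ⬝ᵥ z := by
  rw [bigL_mulVec_dotProduct]
  refine Finset.sum_nonneg fun k _ => ?_
  rw [hWB.dotProduct_lap_mulVec]
  exact div_nonneg (Finset.sum_nonneg fun i _ => Finset.sum_nonneg fun j _ =>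
    mul_nonneg (hAdj i j) (sq_nonneg _)) two_pos.le

/-- Over a strongly connected weight-balanced digraph, the quadratic form of `𝐋` vanishes only
at consensus vectors. -/
lemma StronglyConnected.eq_consensus {Adj : Matrix (Fin n) (Fin n) ℝ}
    (hSC : StronglyConnected Adj) (hWB : WeightBalanced Adj) (hAdj : ∀ i j, 0 ≤ Adj i j)
    (i₀ : Fin n) {z : Fin n × Fin m → ℝ} (hz : (bigL m Adj *ᵥ z) ⬝ᵥ z = 0) :
    z = consensus n fun k => z (i₀, k) := by
  ext ⟨i, k⟩
  refine hSC.eq_of_edges (u := fun i => z (i, k)) (fun i j hij => ?_) i i₀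
  have hnn : ∀ k i j, 0 ≤ Adj i j * (z (i, k) - z (j, k)) ^ 2 := fun k i j =>
    mul_nonneg (hAdj i j) (sq_nonneg _)
  have hnn' : ∀ k, 0 ≤ ∑ i, ∑ j, Adj i j * (z (i, k) - z (j, k)) ^ 2 := fun k =>
    Finset.sum_nonneg fun i _ => Finset.sum_nonneg fun j _ => hnn k i j
  simp only [bigL_mulVec_dotProduct, hWB.dotProduct_lap_mulVec, ← Finset.sum_div,
    div_eq_zero_iff, OfNat.ofNat_ne_zero, or_false] at hz
  have h1 := (Finset.sum_eq_zero_iff_of_nonneg fun k _ => hnn' k).1 hz k (Finset.mem_univ _)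
  have h2 := (Finset.sum_eq_zero_iff_of_nonneg fun i _ =>
    Finset.sum_nonneg fun j _ => hnn k i j).1 h1 i (Finset.mem_univ _)
  have h3 := (Finset.sum_eq_zero_iff_of_nonneg fun j _ => hnn k i j).1 h2 j (Finset.mem_univ _)
  simpa [hij.ne', sub_eq_zero] using h3

lemma onesM_transpose_mulVec (z : Fin n × Fin m → ℝ) :
    (onesM n m)ᵀ *ᵥ z = fun k => ∑ i, z (i, k) := by
  ext k
  simp [onesM, mulVec, dotProduct, Fintype.sum_prod_type]

lemma blkDiag_mulVec_consensus (A : Fin n → Matrix (Fin m) (Fin m) ℝ) (v : Fin m → ℝ) :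
    blkDiag A *ᵥ consensus n v = fun p => (A p.1 *ᵥ v) p.2 := by
  ext ⟨i, k⟩
  simp only [blkDiag, consensus, mulVec, dotProduct, Fintype.sum_prod_type, ite_mul, zero_mul]
  rw [Finset.sum_comm]
  simp

lemma onesM_transpose_mulVec_blkDiag_consensus (A : Fin n → Matrix (Fin m) (Fin m) ℝ)
    (v : Fin m → ℝ) : ((onesM n m)ᵀ * blkDiag A) *ᵥ consensus n v = (∑ i, A i) *ᵥ v := by
  rw [← mulVec_mulVec, blkDiag_mulVec_consensus, onesM_transpose_mulVec]
  ext k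
  simp [sum_mulVec]

lemma onesM_transpose_mulVec_stackVec (b : Fin n → Fin m → ℝ) :
    (onesM n m)ᵀ *ᵥ stackVec b = ∑ i, b i := by
  rw [onesM_transpose_mulVec]
  ext k
  simp [stackVec]

/-- The system matrix `α𝐋 + β𝒜ᵀ𝟙_m𝟙_mᵀ𝒜` of the centralized dynamics. -/
def centralMatrix (Adj : Matrix (Fin n) (Fin n) ℝ) (A : Fin n → Matrix (Fin m) (Fin m) ℝ)
    (α β : ℝ) : Matrix (Fin n × Fin m) (Fin n × Fin m) ℝ :=
  α • bigL m Adj + β • (((onesM n m)ᵀ * blkDiag A)ᵀ * ((onesM n m)ᵀ * blkDiag A))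

lemma WeightBalanced.rhsCentral_eq {Adj : Matrix (Fin n) (Fin n) ℝ} (hWB : WeightBalanced Adj)
    (A : Fin n → Matrix (Fin m) (Fin m) ℝ) (b : Fin n → Fin m → ℝ) (α β : ℝ) {v : Fin m → ℝ}
    (hv : (∑ i, A i) *ᵥ v = ∑ i, b i) (z : Fin n × Fin m → ℝ) :
    rhsCentral Adj A b α β z = -(centralMatrix Adj A α β *ᵥ (z - consensus n v)) := by
  have h : (onesM n m)ᵀ *ᵥ (blkDiag A *ᵥ z - stackVec b)
      = ((onesM n m)ᵀ * blkDiag A) *ᵥ (z - consensus n v) := by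
    rw [mulVec_sub, mulVec_sub, onesM_transpose_mulVec_blkDiag_consensus, hv,
      onesM_transpose_mulVec_stackVec, mulVec_mulVec]
  have hL : bigL m Adj *ᵥ (z - consensus n v) = bigL m Adj *ᵥ z := by
    rw [mulVec_sub, hWB.bigL_mulVec_consensus, sub_zero]
  rw [rhsCentral, ← mulVec_mulVec, h, centralMatrix, add_mulVec, smul_mulVec, smul_mulVec, hL,
    transpose_mul, transpose_transpose, mulVec_mulVec]
  abel

lemma centralMatrix_mulVec_dotProduct (Adj : Matrix (Fin n) (Fin n) ℝ)
    (A : Fin n → Matrix (Fin m) (Fin m) ℝ) (α β : ℝ) (z : Fin n × Fin m → ℝ) :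
    (centralMatrix Adj A α β *ᵥ z) ⬝ᵥ z = α * ((bigL m Adj *ᵥ z) ⬝ᵥ z)
      + β * ((((onesM n m)ᵀ * blkDiag A) *ᵥ z) ⬝ᵥ (((onesM n m)ᵀ * blkDiag A) *ᵥ z)) := by
  rw [centralMatrix, add_mulVec, smul_mulVec, smul_mulVec, add_dotProduct, smul_dotProduct,
    smul_dotProduct, ← mulVec_mulVec, mulVec_transpose, ← dotProduct_mulVec, smul_eq_mul,
    smul_eq_mul]

/-- The quadratic form of the system matrix vanishes only at consensus vectors `𝟙_n ⊗ v` with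
`(∑ A_i) v = 0`. -/
lemma exists_eq_consensus_of_centralMatrix_dotProduct_eq_zero
    {Adj : Matrix (Fin n) (Fin n) ℝ} (hSC : StronglyConnected Adj) (hWB : WeightBalanced Adj)
    (hAdj : ∀ i j, 0 ≤ Adj i j) (i₀ : Fin n) (A : Fin n → Matrix (Fin m) (Fin m) ℝ)
    {α β : ℝ} (hα : 0 < α) (hβ : 0 < β) {z : Fin n × Fin m → ℝ}
    (hz : (centralMatrix Adj A α β *ᵥ z) ⬝ᵥ z = 0) :
    ∃ v : Fin m → ℝ, z = consensus n v ∧ (∑ i, A i) *ᵥ v = 0 := by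
  rw [centralMatrix_mulVec_dotProduct] at hz
  have h1 := mul_nonneg hα.le (hWB.bigL_mulVec_dotProduct_nonneg hAdj z)
  have h2 : 0 ≤ β * ((((onesM n m)ᵀ * blkDiag A) *ᵥ z) ⬝ᵥ
      (((onesM n m)ᵀ * blkDiag A) *ᵥ z)) :=
    mul_nonneg hβ.le (Finset.sum_nonneg fun i _ => mul_self_nonneg _)
  have hL : (bigL m Adj *ᵥ z) ⬝ᵥ z = 0 :=
    (mul_eq_zero.1 (by linarith)).resolve_left hα.ne'
  have hB := dotProduct_self_eq_zero.1
    ((mul_eq_zero.1 (le_antisymm (by linarith) h2)).resolve_left hβ.ne')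
  have hc := hSC.eq_consensus hWB hAdj i₀ hL
  refine ⟨_, hc, ?_⟩
  rw [← onesM_transpose_mulVec_blkDiag_consensus, ← hc, hB]

end Network

/-- Proposition 1: over a strongly connected weight-balanced digraph
with `Ax = b` solvable, for all `α, β > 0`, every trajectory of the centralized
dynamics converges exponentially to a point `x* = 𝟙_n ⊗ x̂` with `Ax̂ = b`. -/
theorem stmt4 {n m : ℕ} (hn : 2 ≤ n)
    (Adj : Matrix (Fin n) (Fin n) ℝ) (hAdj : ∀ i j, 0 ≤ Adj i j)
    (hSC : StronglyConnected Adj) (hWB : WeightBalanced Adj)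
    (A : Fin n → Matrix (Fin m) (Fin m) ℝ) (b : Fin n → Fin m → ℝ)
    (hsol : ∃ x0 : Fin m → ℝ, (∑ i, A i).mulVec x0 = ∑ i, b i)
    (α β : ℝ) (hα : 0 < α) (hβ : 0 < β)
    (x : ℝ → Fin n × Fin m → ℝ)
    (hx : ∀ t : ℝ, 0 ≤ t → HasDerivAt x (rhsCentral Adj A b α β (x t)) t) :
    ∃ xh : Fin m → ℝ, (∑ i, A i).mulVec xh = ∑ i, b i ∧
      ∃ C κ : ℝ, 0 < C ∧ 0 < κ ∧
        ∀ t : ℝ, 0 ≤ t → ‖x t - consensus n xh‖ ≤ C * Real.exp (-κ * t) := by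
  obtain ⟨x₀, hx₀⟩ := hsol
  let i₀ : Fin n := ⟨0, by omega⟩
  let T : EuclideanSpace ℝ (Fin n × Fin m) →L[ℝ] EuclideanSpace ℝ (Fin n × Fin m) :=
    (Matrix.toEuclideanLin (centralMatrix Adj A α β)).toContinuousLinearMap
  have hTapply : ∀ z, T z = WithLp.toLp 2 (centralMatrix Adj A α β *ᵥ z.ofLp) := fun z => rfl
  have hTinner : ∀ z, ⟪T z, z⟫_ℝ = (centralMatrix Adj A α β *ᵥ z.ofLp) ⬝ᵥ z.ofLp := fun z => by
    rw [EuclideanSpace.inner_eq_star_dotProduct, star_trivial, dotProduct_comm, hTapply]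
  have hnonneg : ∀ z, 0 ≤ ⟪T z, z⟫_ℝ := fun z => by
    rw [hTinner, centralMatrix_mulVec_dotProduct]
    exact add_nonneg (mul_nonneg hα.le (hWB.bigL_mulVec_dotProduct_nonneg hAdj _))
      (mul_nonneg hβ.le (Finset.sum_nonneg fun i _ => mul_self_nonneg _))
  have hker : ∀ z, ⟪T z, z⟫_ℝ = 0 → T z = 0 := fun z hz => by
    rw [hTinner] at hz
    obtain ⟨v, hzv, hv⟩ :=
      exists_eq_consensus_of_centralMatrix_dotProduct_eq_zero hSC hWB hAdj i₀ A hα hβ hz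
    rw [hTapply, hzv, centralMatrix, add_mulVec, smul_mulVec, smul_mulVec,
      hWB.bigL_mulVec_consensus, ← mulVec_mulVec, onesM_transpose_mulVec_blkDiag_consensus, hv]
    simp
  have hderiv : ∀ t, 0 ≤ t → HasDerivAt (fun s => WithLp.toLp 2 (x s - consensus n x₀))
      (-T (WithLp.toLp 2 (x t - consensus n x₀))) t := fun t ht => by
    have h := (PiLp.continuousLinearEquiv 2 ℝ
      fun _ : Fin n × Fin m => ℝ).symm.hasFDerivAt.comp_hasDerivAt t
        ((hx t ht).sub_const (consensus n x₀))
    rw [hWB.rhsCentral_eq A b α β hx₀] at h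
    exact h
  obtain ⟨p, hp, C, κ, hC, hκ, hbound⟩ :=
    exists_exponential_limit_of_dissipative T hnonneg hker hderiv
  obtain ⟨v, hpv, hv⟩ :=
    exists_eq_consensus_of_centralMatrix_dotProduct_eq_zero hSC hWB hAdj i₀ A hα hβ
      (z := p.ofLp) (by rw [← hTinner, hp, inner_zero_left])
  refine ⟨x₀ + v, by rw [mulVec_add, hx₀, hv, add_zero], C, κ, hC, hκ, fun t ht => ?_⟩
  refine le_trans ((pi_norm_le_iff_of_nonneg (norm_nonneg _)).2 fun q => ?_) (hbound t ht)
  refine le_trans (le_of_eq ?_) (PiLp.norm_apply_le _ q)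
  simp [hpv, consensus, sub_sub]
end
end

section
/- Let the digraph be strongly connected and weight-balanced, let α, β > 0, and let Q11 = (1/2)α(𝐋 + 𝐋ᵀ) + β𝒜ᵀ𝟙_m𝟙_mᵀ𝒜. Along any trajectory x : [0,∞) → ℝ^{mn} of the centralized dynamics ẋ = −α𝐋x − β𝒜ᵀ𝟙_m𝟙_mᵀ(𝒜x − 𝐛), for every w ∈ ℝ^{mn} with Q11 w = 0 the scalar function t ↦ wᵀx(t) is constant; i.e., the component of x in the null space of Q11 is invariant along the flow. -/
open Matrix

noncomputable section

/-- `Q11 = (1/2)α(𝐋 + 𝐋ᵀ) + β𝒜ᵀ𝟙_m𝟙_mᵀ𝒜`. -/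
def matQ11 {n m : ℕ} (Adj : Matrix (Fin n) (Fin n) ℝ)
    (A : Fin n → Matrix (Fin m) (Fin m) ℝ) (α β : ℝ) :
    Matrix (Fin n × Fin m) (Fin n × Fin m) ℝ :=
  (α / 2) • (bigL m Adj + (bigL m Adj)ᵀ)
    + β • ((blkDiag A)ᵀ * onesM n m * (onesM n m)ᵀ * blkDiag A)

/-- Entrywise formula for a row vector times the Laplacian. -/
theorem vecMul_lap_apply {n : ℕ} (Adj : Matrix (Fin n) (Fin n) ℝ) (y : Fin n → ℝ) (j : Fin n) :
    (y ᵥ* lap Adj) j = ∑ i, Adj i j * (y j - y i) := by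
  rw [lap, Matrix.vecMul_sub, Pi.sub_apply, Matrix.vecMul_diagonal]
  simp only [vecMul, dotProduct, mul_sub, Finset.sum_sub_distrib, ← Finset.sum_mul]
  rw [mul_comm, Finset.sum_congr rfl fun i _ => mul_comm (y i) (Adj i j)]

theorem WeightBalanced.sum_eq {n : ℕ} {Adj : Matrix (Fin n) (Fin n) ℝ} (h : WeightBalanced Adj)
    (i : Fin n) : ∑ j, Adj i j = ∑ j, Adj j i := by
  have hi := congrFun h i
  rw [lap, Matrix.sub_mulVec, Pi.sub_apply, Matrix.mulVec_diagonal] at hi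
  simp only [mulVec, dotProduct, mul_one, Pi.zero_apply] at hi
  linarith

/-- The quadratic form of the Laplacian of a weight-balanced digraph is a weighted sum of
squares of differences along the edges. -/
theorem WeightBalanced.two_mul_vecMul_lap_dotProduct {n : ℕ} {Adj : Matrix (Fin n) (Fin n) ℝ}
    (h : WeightBalanced Adj) (y : Fin n → ℝ) :
    2 * ((y ᵥ* lap Adj) ⬝ᵥ y) = ∑ j, ∑ i, Adj i j * (y j - y i) ^ 2 := by
  have key : ∑ j, ∑ i, Adj i j * y j ^ 2 = ∑ j, ∑ i, Adj i j * y i ^ 2 := by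
    rw [Finset.sum_comm (f := fun j i => Adj i j * y i ^ 2)]
    simp only [← Finset.sum_mul, h.sum_eq]
  have expand : ∑ j, ∑ i, Adj i j * (y j - y i) ^ 2 =
      2 * (∑ j, ∑ i, Adj i j * (y j - y i) * y j)
        - (∑ j, ∑ i, Adj i j * y j ^ 2 - ∑ j, ∑ i, Adj i j * y i ^ 2) := by
    simp only [Finset.mul_sum, ← Finset.sum_sub_distrib]
    exact Finset.sum_congr rfl fun j _ => Finset.sum_congr rfl fun i _ => by ring
  rw [expand, key, sub_self, sub_zero]
  simp only [dotProduct, vecMul_lap_apply, Finset.sum_mul]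

theorem vecMul_bigL_apply {n m : ℕ} (Adj : Matrix (Fin n) (Fin n) ℝ) (w : Fin n × Fin m → ℝ)
    (j : Fin n) (k : Fin m) :
    (w ᵥ* bigL m Adj) (j, k) = ((fun i => w (i, k)) ᵥ* lap Adj) j := by
  simp [bigL, vecMul, dotProduct, Fintype.sum_prod_type, Matrix.one_apply]

theorem WeightBalanced.two_mul_vecMul_bigL_dotProduct {n m : ℕ}
    {Adj : Matrix (Fin n) (Fin n) ℝ} (h : WeightBalanced Adj) (w : Fin n × Fin m → ℝ) :
    2 * ((w ᵥ* bigL m Adj) ⬝ᵥ w) =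
      ∑ k, ∑ j, ∑ i, Adj i j * (w (j, k) - w (i, k)) ^ 2 := by
  simp only [← h.two_mul_vecMul_lap_dotProduct (fun i => w (i, _)), ← Finset.mul_sum]
  congr 1
  simp only [dotProduct, Fintype.sum_prod_type_right, vecMul_bigL_apply]

theorem WeightBalanced.vecMul_bigL_dotProduct_nonneg {n m : ℕ}
    {Adj : Matrix (Fin n) (Fin n) ℝ} (h : WeightBalanced Adj) (hAdj : ∀ i j, 0 ≤ Adj i j)
    (w : Fin n × Fin m → ℝ) : 0 ≤ (w ᵥ* bigL m Adj) ⬝ᵥ w := by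
  have h2 := h.two_mul_vecMul_bigL_dotProduct w
  have : 0 ≤ ∑ k, ∑ j, ∑ i, Adj i j * (w (j, k) - w (i, k)) ^ 2 :=
    Finset.sum_nonneg fun k _ => Finset.sum_nonneg fun j _ => Finset.sum_nonneg fun i _ =>
      mul_nonneg (hAdj i j) (sq_nonneg _)
  linarith

/-- A vector on which the quadratic form of `𝐋` vanishes is in the left null space of `𝐋`. -/
theorem WeightBalanced.vecMul_bigL_eq_zero {n m : ℕ}
    {Adj : Matrix (Fin n) (Fin n) ℝ} (h : WeightBalanced Adj) (hAdj : ∀ i j, 0 ≤ Adj i j)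
    {w : Fin n × Fin m → ℝ} (hw : (w ᵥ* bigL m Adj) ⬝ᵥ w = 0) : w ᵥ* bigL m Adj = 0 := by
  have h2 := h.two_mul_vecMul_bigL_dotProduct w
  rw [hw, mul_zero, eq_comm] at h2
  have nn : ∀ k j i, 0 ≤ Adj i j * (w (j, k) - w (i, k)) ^ 2 := fun k j i =>
    mul_nonneg (hAdj i j) (sq_nonneg _)
  ext ⟨j, k⟩
  rw [vecMul_bigL_apply, vecMul_lap_apply]
  refine Finset.sum_eq_zero fun i _ => ?_
  have hk := (Finset.sum_eq_zero_iff_of_nonneg fun k _ => Finset.sum_nonneg fun j _ =>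
    Finset.sum_nonneg fun i _ => nn k j i).1 h2 k (Finset.mem_univ k)
  have hj := (Finset.sum_eq_zero_iff_of_nonneg fun j _ =>
    Finset.sum_nonneg fun i _ => nn k j i).1 hk j (Finset.mem_univ j)
  have hi := (Finset.sum_eq_zero_iff_of_nonneg fun i _ => nn k j i).1 hj i (Finset.mem_univ i)
  simpa using hi

/-- The quadratic form of `Q11` splits into a Laplacian part and a squared norm. -/
theorem dotProduct_matQ11_mulVec {n m : ℕ} (Adj : Matrix (Fin n) (Fin n) ℝ)
    (A : Fin n → Matrix (Fin m) (Fin m) ℝ) (α β : ℝ) (w : Fin n × Fin m → ℝ) :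
    w ⬝ᵥ matQ11 Adj A α β *ᵥ w = α * ((w ᵥ* bigL m Adj) ⬝ᵥ w) +
      β * ((w ᵥ* ((blkDiag A)ᵀ * onesM n m)) ⬝ᵥ (w ᵥ* ((blkDiag A)ᵀ * onesM n m))) := by
  have e : (blkDiag A)ᵀ * onesM n m * (onesM n m)ᵀ * blkDiag A =
      ((blkDiag A)ᵀ * onesM n m) * ((blkDiag A)ᵀ * onesM n m)ᵀ := by
    simp [Matrix.transpose_mul, Matrix.mul_assoc]
  have t : w ⬝ᵥ (bigL m Adj)ᵀ *ᵥ w = (w ᵥ* bigL m Adj) ⬝ᵥ w := by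
    rw [Matrix.mulVec_transpose, dotProduct_comm]
  rw [matQ11, e, Matrix.add_mulVec, Matrix.smul_mulVec, Matrix.smul_mulVec, Matrix.add_mulVec,
    dotProduct_add, dotProduct_smul, dotProduct_smul, dotProduct_add, t,
    Matrix.dotProduct_mulVec, ← Matrix.mulVec_mulVec, Matrix.dotProduct_mulVec w,
    Matrix.mulVec_transpose, smul_eq_mul, smul_eq_mul]
  ring

/-- along any trajectory of the centralized dynamics, for every `w`
in the null space of `Q11`, the component `wᵀx(t)` is constant in time. -/
theorem stmt5 {n m : ℕ} (hn : 2 ≤ n)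
    (Adj : Matrix (Fin n) (Fin n) ℝ) (hAdj : ∀ i j, 0 ≤ Adj i j)
    (hSC : StronglyConnected Adj) (hWB : WeightBalanced Adj)
    (A : Fin n → Matrix (Fin m) (Fin m) ℝ) (b : Fin n → Fin m → ℝ)
    (α β : ℝ) (hα : 0 < α) (hβ : 0 < β)
    (x : ℝ → Fin n × Fin m → ℝ)
    (hx : ∀ t : ℝ, 0 ≤ t → HasDerivAt x (rhsCentral Adj A b α β (x t)) t) :
    ∀ w : Fin n × Fin m → ℝ, (matQ11 Adj A α β).mulVec w = 0 →
      ∀ t : ℝ, 0 ≤ t → w ⬝ᵥ x t = w ⬝ᵥ x 0 := by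
  intro w hw t ht
  have hq := dotProduct_matQ11_mulVec Adj A α β w
  rw [hw, dotProduct_zero] at hq
  have hLnn := mul_nonneg hα.le (hWB.vecMul_bigL_dotProduct_nonneg hAdj w)
  have hBnn := mul_nonneg hβ.le (Finset.sum_nonneg fun i (_ : i ∈ Finset.univ) =>
    mul_self_nonneg ((w ᵥ* ((blkDiag A)ᵀ * onesM n m)) i))
  change 0 ≤ β * ((w ᵥ* ((blkDiag A)ᵀ * onesM n m)) ⬝ᵥ (w ᵥ* ((blkDiag A)ᵀ * onesM n m)))
    at hBnn
  have hL : w ᵥ* bigL m Adj = 0 := hWB.vecMul_bigL_eq_zero hAdj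
    ((mul_eq_zero.1 (by linarith)).resolve_left hα.ne')
  have hB : w ᵥ* ((blkDiag A)ᵀ * onesM n m) = 0 := dotProduct_self_eq_zero.1
    ((mul_eq_zero.1 (by linarith)).resolve_left hβ.ne')
  have hrhs (y : Fin n × Fin m → ℝ) : w ⬝ᵥ rhsCentral Adj A b α β y = 0 := by
    rw [rhsCentral, dotProduct_sub, dotProduct_neg, dotProduct_smul, dotProduct_smul,
      Matrix.dotProduct_mulVec, Matrix.dotProduct_mulVec, ← Matrix.vecMul_vecMul, hL, hB]
    simp
  have hd (s : ℝ) (hs : 0 ≤ s) : HasDerivAt (fun s => w ⬝ᵥ x s) 0 s := by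
    rw [← hrhs (x s)]
    exact HasDerivAt.fun_sum fun p _ => (hasDerivAt_pi.1 (hx s hs) p).const_mul (w p)
  exact constant_of_has_deriv_right_zero
    (fun s hs => (hd s hs.1).continuousAt.continuousWithinAt)
    (fun s hs => (hd s hs.1).hasDerivWithinAt) t ⟨ht, le_rfl⟩
end
end

section
/- Let the digraph be strongly connected and weight-balanced and let α, β, γ > 0. Let (x(t), y(t)) be a trajectory of the distributed dynamics ẋ = −α𝐋x − nβ𝒜ᵀy, ẏ = −α𝒜𝐋x − nβ𝒜𝒜ᵀy − γ𝐋y whose initial condition satisfies 𝟙_mᵀy(0) = 𝟙_mᵀ(𝒜x(0) − 𝐛). Then the error variable e(t) = y(t) − (1/n)𝟙_m𝟙_mᵀ(𝒜x(t) − 𝐛) satisfies 𝟙_mᵀ e(t) = 0 for all t ≥ 0. -/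
open Matrix

noncomputable section

/-- Right-hand side of the `x`-dynamics of the distributed algorithm:
`ẋ = −α𝐋x − nβ𝒜ᵀy`. -/
def rhsX {n m : ℕ} (Adj : Matrix (Fin n) (Fin n) ℝ)
    (A : Fin n → Matrix (Fin m) (Fin m) ℝ) (α β : ℝ)
    (x y : Fin n × Fin m → ℝ) : Fin n × Fin m → ℝ :=
  -(α • (bigL m Adj).mulVec x) - ((n : ℝ) * β) • (blkDiag A)ᵀ.mulVec y

/-- Right-hand side of the `y`-dynamics of the distributed algorithm:
`ẏ = −α𝒜𝐋x − nβ𝒜𝒜ᵀy − γ𝐋y`. -/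
def rhsY {n m : ℕ} (Adj : Matrix (Fin n) (Fin n) ℝ)
    (A : Fin n → Matrix (Fin m) (Fin m) ℝ) (α β γ : ℝ)
    (x y : Fin n × Fin m → ℝ) : Fin n × Fin m → ℝ :=
  -(α • (blkDiag A * bigL m Adj).mulVec x)
    - ((n : ℝ) * β) • (blkDiag A * (blkDiag A)ᵀ).mulVec y
    - γ • (bigL m Adj).mulVec y

theorem sum_lap_column {n : ℕ} (Adj : Matrix (Fin n) (Fin n) ℝ) (j : Fin n) :
    ∑ i, lap Adj i j = 0 := by
  simp [lap, Matrix.diagonal_apply, Finset.sum_sub_distrib]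

theorem onesM_transpose_mul_bigL {n : ℕ} (m : ℕ) (Adj : Matrix (Fin n) (Fin n) ℝ) :
    (onesM n m)ᵀ * bigL m Adj = 0 := by
  ext k ⟨j, l⟩
  simp only [Matrix.mul_apply, Matrix.transpose_apply, onesM, bigL, Fintype.sum_prod_type,
    Matrix.kroneckerMap_apply, ite_mul, one_mul, zero_mul, Finset.sum_ite_eq', Finset.mem_univ,
    if_true, Matrix.zero_apply]
  change ∑ i, lap Adj i j * (1 : Matrix (Fin m) (Fin m) ℝ) k l = 0
  rw [← Finset.sum_mul, sum_lap_column, zero_mul]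

theorem onesM_transpose_mul_onesM (n m : ℕ) :
    (onesM n m)ᵀ * onesM n m = (n : ℝ) • (1 : Matrix (Fin m) (Fin m) ℝ) := by
  ext k l
  rcases eq_or_ne k l with rfl | h
  · simp [Matrix.mul_apply, onesM, Fintype.sum_prod_type]
  · simp [Matrix.mul_apply, onesM, Fintype.sum_prod_type, h, h.symm]

theorem HasDerivAt.matrix_mulVec {p q : Type*} [Fintype p] [Fintype q]
    (M : Matrix p q ℝ) {f : ℝ → q → ℝ} {f' : q → ℝ} {t : ℝ} (hf : HasDerivAt f f' t) :
    HasDerivAt (fun s => M *ᵥ f s) (M *ᵥ f') t :=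
  (LinearMap.toContinuousLinearMap M.mulVecLin).hasFDerivAt.comp_hasDerivAt t hf

theorem rhsY_sub_blkDiag_mulVec_rhsX {n m : ℕ} (Adj : Matrix (Fin n) (Fin n) ℝ)
    (A : Fin n → Matrix (Fin m) (Fin m) ℝ) (α β γ : ℝ) (x y : Fin n × Fin m → ℝ) :
    rhsY Adj A α β γ x y - blkDiag A *ᵥ rhsX Adj A α β x y = -(γ • bigL m Adj *ᵥ y) := by
  simp only [rhsX, rhsY, Matrix.mulVec_sub, Matrix.mulVec_neg, Matrix.mulVec_smul,
    Matrix.mulVec_mulVec]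
  abel

/-- The quantity `𝟙_mᵀ(y − 𝒜x)` is conserved along trajectories. -/
theorem onesM_transpose_mulVec_sub_eq_initial {n m : ℕ} (Adj : Matrix (Fin n) (Fin n) ℝ)
    (A : Fin n → Matrix (Fin m) (Fin m) ℝ) (α β γ : ℝ) (x y : ℝ → Fin n × Fin m → ℝ)
    (hx : ∀ t : ℝ, 0 ≤ t → HasDerivAt x (rhsX Adj A α β (x t) (y t)) t)
    (hy : ∀ t : ℝ, 0 ≤ t → HasDerivAt y (rhsY Adj A α β γ (x t) (y t)) t)
    {t : ℝ} (ht : 0 ≤ t) :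
    (onesM n m)ᵀ *ᵥ (y t - blkDiag A *ᵥ x t) = (onesM n m)ᵀ *ᵥ (y 0 - blkDiag A *ᵥ x 0) := by
  have hderiv : ∀ s : ℝ, 0 ≤ s →
      HasDerivAt (fun s => (onesM n m)ᵀ *ᵥ (y s - blkDiag A *ᵥ x s)) 0 s := by
    intro s hs
    have h := ((hy s hs).sub ((hx s hs).matrix_mulVec (blkDiag A))).matrix_mulVec (onesM n m)ᵀ
    rw [rhsY_sub_blkDiag_mulVec_rhsX, Matrix.mulVec_neg, Matrix.mulVec_smul,
      Matrix.mulVec_mulVec, onesM_transpose_mul_bigL, Matrix.zero_mulVec, smul_zero,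
      neg_zero] at h
    exact h
  exact constant_of_has_deriv_right_zero
    (fun s hs => (hderiv s hs.1).continuousAt.continuousWithinAt)
    (fun s hs => (hderiv s hs.1).hasDerivWithinAt) t ⟨ht, le_rfl⟩

/-- along any trajectory of the distributed dynamics whose initial
condition satisfies `𝟙_mᵀy(0) = 𝟙_mᵀ(𝒜x(0) − 𝐛)`, the error
`e(t) = y(t) − (1/n)𝟙_m𝟙_mᵀ(𝒜x(t) − 𝐛)` satisfies `𝟙_mᵀe(t) = 0` for all `t ≥ 0`. -/
theorem stmt7 {n m : ℕ} (hn : 2 ≤ n)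
    (Adj : Matrix (Fin n) (Fin n) ℝ) (hAdj : ∀ i j, 0 ≤ Adj i j)
    (hSC : StronglyConnected Adj) (hWB : WeightBalanced Adj)
    (A : Fin n → Matrix (Fin m) (Fin m) ℝ) (b : Fin n → Fin m → ℝ)
    (α β γ : ℝ) (hα : 0 < α) (hβ : 0 < β) (hγ : 0 < γ)
    (x y : ℝ → Fin n × Fin m → ℝ)
    (hx : ∀ t : ℝ, 0 ≤ t → HasDerivAt x (rhsX Adj A α β (x t) (y t)) t)
    (hy : ∀ t : ℝ, 0 ≤ t → HasDerivAt y (rhsY Adj A α β γ (x t) (y t)) t)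
    (hinit : (onesM n m)ᵀ.mulVec (y 0) =
      (onesM n m)ᵀ.mulVec ((blkDiag A).mulVec (x 0) - stackVec b)) :
    ∀ t : ℝ, 0 ≤ t →
      (onesM n m)ᵀ.mulVec (y t - ((n : ℝ))⁻¹ •
        (onesM n m * (onesM n m)ᵀ).mulVec ((blkDiag A).mulVec (x t) - stackVec b)) = 0 := by
  intro t ht
  have hn0 : (n : ℝ) ≠ 0 := by
    have : n ≠ 0 := by omega
    exact_mod_cast this
  have hconst := onesM_transpose_mulVec_sub_eq_initial Adj A α β γ x y hx hy ht
  simp only [Matrix.mulVec_sub] at hconst hinit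
  rw [Matrix.mulVec_sub, Matrix.mulVec_smul, Matrix.mulVec_mulVec, ← Matrix.mul_assoc,
    onesM_transpose_mul_onesM, Matrix.smul_mul, Matrix.one_mul, Matrix.smul_mulVec,
    inv_smul_smul₀ hn0, Matrix.mulVec_sub, sub_sub_eq_add_sub, add_sub_right_comm, hconst, hinit]
  abel
end
end
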